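/- arXiv:2211.12397 — 2 statements merged into one kernel-verified Lean document; each statement's English description precedes it below -/
import Mathlib

section
/- For every sequence (s_k) of positive integers and every i ≥ 1, every word w ∈ L^{(s)} of length at least 2^{i+2} · s_1 s_2 ⋯ s_i contains α_i^{(s)} as a factor. -/
/-- The complement of a binary word: negate every letter. -/
def wordCompl (w : List Bool) : List Bool := w.map Bool.not

/-- `wordPow u k` is the concatenation of `k` copies of `u`. -/
def wordPow (u : List Bool) (k : ℕ) : List Bool := (List.replicate k u).flatten

/-- Pouzet's words `α_i^{(s)}`: `α_1 = [0,1]`, `α_{i+1} = α_i^{s_i} ++ ᾱ_i^{s_i}`. -/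
def alphaWord (s : ℕ → ℕ) : ℕ → List Bool
  | 0 => []
  | 1 => [false, true]
  | (i + 2) => wordPow (alphaWord s (i + 1)) (s (i + 1)) ++
      wordPow (wordCompl (alphaWord s (i + 1))) (s (i + 1))

/-- The language `L^{(s)}` of all factors of the words `α_i^{(s)}`, `i ≥ 1`. -/
def langL (s : ℕ → ℕ) : Set (List Bool) :=
  {w | ∃ i, 1 ≤ i ∧ w <:+: alphaWord s i}


theorem wc_append (u v : List Bool) : wordCompl (u ++ v) = wordCompl u ++ wordCompl v := by
  simp [wordCompl]

theorem wc_wc (u : List Bool) : wordCompl (wordCompl u) = u := by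
  simp [wordCompl, Function.comp_def]

theorem wp_succ (u : List Bool) (k : ℕ) : wordPow u (k + 1) = u ++ wordPow u k := by
  simp [wordPow, List.replicate_succ]

theorem wc_wp (u : List Bool) (k : ℕ) : wordCompl (wordPow u k) = wordPow (wordCompl u) k := by
  induction k with
  | zero => simp [wordPow, wordCompl]
  | succ k ih => rw [wp_succ, wp_succ, wc_append, ih]

theorem wc_length (u : List Bool) : (wordCompl u).length = u.length := by
  simp [wordCompl]

theorem wp_length (u : List Bool) (k : ℕ) : (wordPow u k).length = k * u.length := by
  simp [wordPow]

/-- concatenations of `a` and its complement -/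
inductive Conc (a : List Bool) : List Bool → Prop
  | nil : Conc a []
  | pos (u : List Bool) : Conc a u → Conc a (a ++ u)
  | neg (u : List Bool) : Conc a u → Conc a (wordCompl a ++ u)

theorem Conc.append {a u v : List Bool} (hu : Conc a u) (hv : Conc a v) : Conc a (u ++ v) := by
  induction hu with
  | nil => simpa using hv
  | pos u _ ih => rw [List.append_assoc]; exact .pos _ ih
  | neg u _ ih => rw [List.append_assoc]; exact .neg _ ih

theorem Conc.compl {a u : List Bool} (hu : Conc a u) : Conc a (wordCompl u) := by
  induction hu with
  | nil => exact .nil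
  | pos u _ ih => rw [wc_append]; exact .neg _ ih
  | neg u _ ih => rw [wc_append, wc_wc]; exact .pos _ ih

theorem Conc.pow {a u : List Bool} (hu : Conc a u) (k : ℕ) : Conc a (wordPow u k) := by
  induction k with
  | zero => exact .nil
  | succ k ih => rw [wp_succ]; exact hu.append ih

theorem conc_alpha (s : ℕ → ℕ) (i d : ℕ) :
    Conc (alphaWord s (i + 1)) (alphaWord s (i + 1 + d)) := by
  induction d with
  | zero => simpa using Conc.pos (a := alphaWord s (i + 1)) [] .nil
  | succ d ih =>
    have e : i + 1 + (d + 1) = (i + d) + 2 := by omega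
    have e' : i + 1 + d = (i + d) + 1 := by omega
    rw [e, alphaWord]
    rw [e'] at ih
    exact (ih.pow _).append (ih.compl.pow _)

theorem Conc.prefix {a u p : List Bool} (hu : Conc a u) (hp : p <+: u) (ha : 0 < a.length)
    (hl : a.length ≤ p.length) : a <+: p ∨ wordCompl a <+: p := by
  cases hu with
  | nil => have := hp.length_le; simp at this; simp [this] at hl; simp [hl] at ha
  | pos u _ => exact .inl (List.prefix_of_prefix_length_le (List.prefix_append _ _) hp hl)
  | neg u _ =>
    exact .inr (List.prefix_of_prefix_length_le (List.prefix_append _ _) hp (by rwa [wc_length]))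

theorem block_step {a b u w : List Bool} (hb : b.length = a.length) (hu : Conc a u)
    (ih : w <:+: u → a <:+: w ∨ wordCompl a <:+: w) (ha : 0 < a.length)
    (hl : 2 * a.length ≤ w.length) (hw : w <:+: b ++ u) : a <:+: w ∨ wordCompl a <:+: w := by
  rw [List.infix_append_iff] at hw
  rcases hw with h | h | ⟨x, y, rfl, hx, hy⟩
  · have := h.length_le; omega
  · exact ih h
  · have := hx.length_le
    rw [List.length_append] at hl
    rcases hu.prefix hy ha (by omega) with h | h
    · exact .inl (h.isInfix.trans (List.suffix_append _ _).isInfix)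
    · exact .inr (h.isInfix.trans (List.suffix_append _ _).isInfix)

theorem Conc.block {a u w : List Bool} (hu : Conc a u) (ha : 0 < a.length)
    (hl : 2 * a.length ≤ w.length) (hw : w <:+: u) : a <:+: w ∨ wordCompl a <:+: w := by
  induction hu with
  | nil => have := hw.length_le; simp at this; simp [this] at hl; simp [hl] at ha
  | pos u h ih => exact block_step rfl h ih ha hl hw
  | neg u h ih => exact block_step (wc_length a) h ih ha hl hw

theorem alpha_length (s : ℕ → ℕ) (i : ℕ) :
    (alphaWord s (i + 1)).length = 2 ^ (i + 1) * ∏ k ∈ Finset.Icc 1 i, s k := by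
  induction i with
  | zero => simp [alphaWord]
  | succ i ih =>
    rw [alphaWord, List.length_append, wp_length, wp_length, wc_length, ih,
      Finset.prod_Icc_succ_top (by omega)]
    ring

theorem infix_wp (u : List Bool) (k : ℕ) (hk : 0 < k) : u <:+: wordPow u k := by
  obtain ⟨k, rfl⟩ := Nat.exists_eq_succ_of_ne_zero hk.ne'
  rw [Nat.succ_eq_add_one, wp_succ]
  exact (List.prefix_append _ _).isInfix

theorem alpha_mono (s : ℕ → ℕ) (hs : ∀ k, 0 < s k) (j d : ℕ) :
    alphaWord s (j + 1) <:+: alphaWord s (j + 1 + d) := by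
  induction d with
  | zero => exact List.infix_rfl
  | succ d ih =>
    have e : j + 1 + (d + 1) = (j + d) + 2 := by omega
    have e' : j + 1 + d = (j + d) + 1 := by omega
    rw [e, alphaWord]
    rw [e'] at ih
    exact (ih.trans (infix_wp _ _ (hs _))).trans (List.prefix_append _ _).isInfix

theorem long_words_contain_alpha (s : ℕ → ℕ) (hs : ∀ k, 0 < s k) (i : ℕ) (hi : 1 ≤ i)
    (w : List Bool) (hw : w ∈ langL s)
    (hlen : 2 ^ (i + 2) * ∏ k ∈ Finset.Icc 1 i, s k ≤ w.length) :
    alphaWord s i <:+: w := by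
  obtain ⟨j, hj, hw⟩ := hw
  have hL := alpha_length s i
  have hpos : 0 < (alphaWord s (i + 1)).length := by
    rw [hL]
    exact Nat.mul_pos (by positivity) (Finset.prod_pos fun k _ => hs k)
  have hl : 2 * (alphaWord s (i + 1)).length ≤ w.length := by
    rw [hL]; refine le_trans (le_of_eq ?_) hlen; ring
  obtain ⟨m, rfl⟩ : ∃ m, i = m + 1 := ⟨i - 1, by omega⟩
  have hw' : ∃ d, w <:+: alphaWord s (m + 1 + 1 + d) := by
    rcases le_total j (m + 2) with h | h
    · refine ⟨0, hw.trans ?_⟩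
      have := alpha_mono s hs (j - 1) (m + 2 - j)
      rwa [show j - 1 + 1 = j by omega, show j + (m + 2 - j) = m + 1 + 1 + 0 by omega] at this
    · exact ⟨j - (m + 2), by rwa [show m + 1 + 1 + (j - (m + 2)) = j by omega]⟩
  obtain ⟨d, hd⟩ := hw'
  rcases (conc_alpha s (m + 1) d).block hpos hl hd with h | h
  · exact (alpha_mono s hs m 1).trans h
  · refine List.IsInfix.trans ?_ h
    rw [alphaWord, wc_append, wc_wp, wc_wp, wc_wc]
    exact (infix_wp _ _ (hs _)).trans (List.suffix_append _ _).isInfix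
end

section
/- For every sequence (s_k) of positive integers, the language P^{(s)} is well-quasi-ordered under the factor order: for every function f : ℕ → List (Bool × Bool) with f n ∈ P^{(s)} for all n, there exist indices m < n such that f m is a factor (List.IsInfix) of f n. -/
/-- The substitution `ρ` sending `0 ↦ d r_d` and `1 ↦ u r_u`, where the pin alphabet
`{d, r_d, u, r_u}` is modelled as `Bool × Bool` with `d = (false, false)`,
`r_d = (false, true)`, `u = (true, false)`, `r_u = (true, true)`. -/
def rho (w : List Bool) : List (Bool × Bool) :=
  (w.map (fun b => [(b, false), (b, true)])).flatten

/-- The language `P^{(s)}`: the factor closure of `ρ(L^{(s)})`. -/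
def langP (s : ℕ → ℕ) : Set (List (Bool × Bool)) :=
  {v | ∃ w ∈ langL s, v <:+: rho w}


theorem lw_block {β : Type*} (u : List β) (N : ℕ) : ∀ (bs : List (List β)) (a v c : List β),
    (∀ b ∈ bs, b.length = N ∧ u <:+: b) → a ++ v ++ c = bs.flatten → 2 * N + 1 ≤ v.length →
    u <:+: v := by
  intro bs
  induction bs with
  | nil =>
    intro a v c _ h hv
    have := congrArg List.length h
    simp at this
    simp [this] at hv
  | cons b bs ih =>
    intro a v c hb h hv
    have hb1 := hb b (by simp)
    rw [List.flatten_cons, List.append_assoc, List.append_eq_append_iff] at h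
    rcases h with ⟨a', h1, h2⟩ | ⟨a', h1, h2⟩
    · cases bs with
      | nil =>
        have e1 := congrArg List.length h1
        have e2 := congrArg List.length h2
        simp at e1 e2
        omega
      | cons b2 bs =>
        have hb2 := hb b2 (by simp)
        have e1 := congrArg List.length h1
        simp at e1
        rw [List.flatten_cons, ← List.append_assoc] at h2
        have hp : (a' ++ b2) <+: v := by
          refine List.prefix_of_prefix_length_le (l₃ := v ++ c) ?_ (List.prefix_append _ _) ?_
          · rw [h2]; exact List.prefix_append _ _
          · simp; omega
        exact hb2.2.trans ((List.suffix_append a' b2).isInfix.trans hp.isInfix)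
    · refine ih a' v c (fun x hx => hb x (by simp [hx])) ?_ hv
      rw [List.append_assoc]; exact h2.symm

theorem lw_compl_append (x y : List Bool) :
    wordCompl (x ++ y) = wordCompl x ++ wordCompl y := by simp [wordCompl]

theorem lw_compl_compl (x : List Bool) : wordCompl (wordCompl x) = x := by
  simp [wordCompl, Function.comp_def]

theorem lw_rho_infix {x y : List Bool} (h : x <:+: y) : rho x <:+: rho y := by
  obtain ⟨a, c, rfl⟩ := h
  exact ⟨rho a, rho c, by simp [rho]⟩

theorem lw_compl_infix {x y : List Bool} (h : x <:+: y) : wordCompl x <:+: wordCompl y := by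
  obtain ⟨a, c, rfl⟩ := h
  exact ⟨wordCompl a, wordCompl c, by simp [wordCompl]⟩

def LwB (X w : List Bool) : Prop :=
  ∃ bs : List (List Bool), (∀ b ∈ bs, b = X ∨ b = wordCompl X) ∧ w = bs.flatten

theorem LwB.app {X v w : List Bool} (hv : LwB X v) (hw : LwB X w) : LwB X (v ++ w) := by
  obtain ⟨bs, h, rfl⟩ := hv
  obtain ⟨cs, h', rfl⟩ := hw
  refine ⟨bs ++ cs, ?_, by simp⟩
  intro b hb
  rcases List.mem_append.1 hb with hb | hb
  · exact h b hb
  · exact h' b hb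

theorem LwB.pw {X w : List Bool} (hw : LwB X w) (k : ℕ) : LwB X (wordPow w k) := by
  induction k with
  | zero => exact ⟨[], by simp, by simp [wordPow]⟩
  | succ k ih =>
    have : wordPow w (k+1) = w ++ wordPow w k := by simp [wordPow, List.replicate_succ]
    rw [this]; exact hw.app ih

theorem LwB.cp {X w : List Bool} (hw : LwB X w) : LwB X (wordCompl w) := by
  obtain ⟨bs, h, rfl⟩ := hw
  refine ⟨bs.map wordCompl, ?_, ?_⟩
  · intro b hb
    obtain ⟨c, hc, rfl⟩ := List.mem_map.1 hb
    rcases h c hc with rfl | rfl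
    · exact Or.inr rfl
    · exact Or.inl (lw_compl_compl X)
  · simp only [wordCompl, List.map_flatten]; rfl

theorem lw_alpha (s : ℕ → ℕ) (i k : ℕ) : LwB (alphaWord s (i+1)) (alphaWord s (i+1+k)) := by
  induction k with
  | zero => exact ⟨[alphaWord s (i+1)], by simp, by simp⟩
  | succ k ih =>
    have e : i + 1 + (k+1) = (i + k) + 2 := by omega
    have e' : i + 1 + k = i + k + 1 := by omega
    rw [e'] at ih
    rw [e, alphaWord]
    exact (ih.pw _).app (ih.cp.pw _)

theorem lw_pow_infix (w : List Bool) (k : ℕ) (hk : 0 < k) : w <:+: wordPow w k := by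
  obtain ⟨k, rfl⟩ : ∃ m, k = m + 1 := ⟨k - 1, by omega⟩
  exact ⟨[], wordPow w k, by simp [wordPow, List.replicate_succ]⟩

theorem lw_step (s : ℕ → ℕ) (hs : ∀ k, 0 < s k) (i : ℕ) :
    alphaWord s (i+1) <:+: alphaWord s (i+2) ∧
    wordCompl (alphaWord s (i+1)) <:+: alphaWord s (i+2) := by
  rw [alphaWord]
  exact ⟨(lw_pow_infix _ _ (hs _)).trans (List.prefix_append _ _).isInfix,
    (lw_pow_infix _ _ (hs _)).trans (List.suffix_append _ _).isInfix⟩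

theorem lw_mono (s : ℕ → ℕ) (hs : ∀ k, 0 < s k) (i k : ℕ) :
    alphaWord s (i+1) <:+: alphaWord s (i+1+k) := by
  induction k with
  | zero => exact List.infix_rfl
  | succ k ih =>
    have e : i + 1 + (k+1) = (i + k) + 2 := by omega
    have e' : i + 1 + k = i + k + 1 := by omega
    rw [e'] at ih
    rw [e]
    exact ih.trans (lw_step s hs _).1

theorem lw_rec (s : ℕ → ℕ) (hs : ∀ k, 0 < s k) (u : List (Bool × Bool)) (hu : u ∈ langP s) :
    ∃ M, ∀ v ∈ langP s, M ≤ v.length → u <:+: v := by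
  obtain ⟨w, ⟨i, hi, hw⟩, huw⟩ := hu
  obtain ⟨i, rfl⟩ : ∃ m, i = m + 1 := ⟨i - 1, by omega⟩
  have hu := huw.trans (lw_rho_infix hw)
  refine ⟨2 * (rho (alphaWord s (i+2))).length + 1, ?_⟩
  rintro v ⟨w', ⟨j, hj, hw'⟩, hvw⟩ hlen
  obtain ⟨j, rfl⟩ : ∃ m, j = m + 1 := ⟨j - 1, by omega⟩
  have h1 : w' <:+: alphaWord s (i + 1 + 1 + j) := by
    have := lw_mono s hs j (i+1)
    rw [show j + 1 + (i+1) = i + 1 + 1 + j by omega] at this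
    exact hw'.trans this
  obtain ⟨bs, hbs, e⟩ := lw_alpha s (i+1) j
  obtain ⟨a, c, hac⟩ := hvw.trans (lw_rho_infix h1)
  refine lw_block u _ (bs.map rho) a v c ?_ ?_ hlen
  · intro b hb
    obtain ⟨b', hb', rfl⟩ := List.mem_map.1 hb
    rcases hbs b' hb' with rfl | rfl
    · exact ⟨rfl, hu.trans (lw_rho_infix (lw_step s hs i).1)⟩
    · refine ⟨by simp [rho, wordCompl, Function.comp_def], hu.trans (lw_rho_infix ?_)⟩
      have := lw_compl_infix (lw_step s hs i).2
      rwa [lw_compl_compl] at this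
  · rw [hac, e]
    clear hbs e
    induction bs with
    | nil => rfl
    | cons b bs ih =>
      rw [List.map_cons, List.flatten_cons, List.flatten_cons, ← ih]; simp [rho]

theorem langP_wqo (s : ℕ → ℕ) (hs : ∀ k, 0 < s k) :
    ∀ f : ℕ → List (Bool × Bool), (∀ n, f n ∈ langP s) →
      ∃ m n, m < n ∧ f m <:+: f n := by
  intro f hf
  obtain ⟨M, hM⟩ := lw_rec s hs (f 0) (hf 0)
  by_contra hcon
  push Not at hcon
  have hfin := List.finite_length_lt (Bool × Bool) M
  have hlt : ∀ n, f (n+1) ∈ {l : List (Bool × Bool) | l.length < M} := by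
    intro n
    by_contra h
    exact hcon 0 (n+1) (by omega) (hM _ (hf _) (by simpa using h))
  obtain ⟨m, n, hmn, he⟩ := Set.Finite.exists_lt_map_eq_of_forall_mem hlt hfin
  exact hcon (m+1) (n+1) (by omega) (he ▸ List.infix_rfl)
end
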